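/- arXiv:2502.19504 — 6 statements merged into one kernel-verified Lean document; each statement's English description precedes it below -/
import Mathlib

section
/- Let n ≥ 1 and let H be a finite abelian group (under matrix multiplication) of n-qubit Pauli strings, each with phase φ ∈ {+1, −1}, such that −I ∉ H. Then the 2^n × 2^n matrix ρ = (1/2^n) ∑_{h ∈ H} h is Hermitian, has trace 1, and satisfies ρ² = (|H|/2^n)·ρ. Consequently ρ is positive semidefinite and every eigenvalue of ρ equals either 0 or |H|/2^n. -/
open Matrix BigOperators
open scoped ComplexOrder

/-- The four single-qubit Pauli matrices `σ⁰, σ¹, σ², σ³`. -/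
noncomputable def pauliMat : Fin 4 → Matrix (Fin 2) (Fin 2) ℂ
  | 0 => !![1, 0; 0, 1]
  | 1 => !![0, 1; 1, 0]
  | 2 => !![0, -Complex.I; Complex.I, 0]
  | 3 => !![1, 0; 0, -1]

/-- The Pauli string with global phase `φ` and type `α`, as a matrix on `ι` qubits. -/
noncomputable def pauliString {ι : Type*} [Fintype ι] (φ : ℂ) (α : ι → Fin 4) :
    Matrix (ι → Fin 2) (ι → Fin 2) ℂ :=
  Matrix.of fun x y => φ * ∏ j, pauliMat (α j) (x j) (y j)

theorem pauliMat_zero : pauliMat 0 = 1 := by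
  ext i j
  fin_cases i <;> fin_cases j <;> simp [pauliMat]

theorem pauliMat_isHermitian (a : Fin 4) : (pauliMat a).IsHermitian := by
  ext i j
  fin_cases a <;> fin_cases i <;> fin_cases j <;> simp [pauliMat]

theorem pauliMat_mul_self (a : Fin 4) : pauliMat a * pauliMat a = 1 := by
  ext i j
  fin_cases a <;> fin_cases i <;> fin_cases j <;> simp [pauliMat]

theorem pauliMat_trace_of_ne_zero {a : Fin 4} (ha : a ≠ 0) : (pauliMat a).trace = 0 := by
  fin_cases a <;> simp_all [pauliMat, Matrix.trace, Fin.sum_univ_two]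

theorem prod_one_apply {ι κ : Type*} [Fintype ι] [DecidableEq κ] [DecidableEq (ι → κ)]
    (x y : ι → κ) :
    ∏ j, (1 : Matrix κ κ ℂ) (x j) (y j) = (1 : Matrix (ι → κ) (ι → κ) ℂ) x y := by
  simp only [Matrix.one_apply, Finset.prod_ite_zero, Finset.prod_const_one, Finset.mem_univ,
    true_implies, funext_iff]

theorem pauliString_zero {ι : Type*} [Fintype ι] [DecidableEq (ι → Fin 2)] (φ : ℂ) :
    pauliString φ (0 : ι → Fin 4) = φ • 1 := by
  ext x y
  simp [pauliString, pauliMat_zero, prod_one_apply]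

theorem pauliString_isHermitian {ι : Type*} [Fintype ι] {φ : ℂ} (hφ : star φ = φ)
    (α : ι → Fin 4) : (pauliString φ α).IsHermitian := by
  ext x y
  simp only [pauliString, Matrix.conjTranspose_apply, Matrix.of_apply, star_mul', hφ, star_prod,
    (pauliMat_isHermitian _).apply]

theorem pauliString_mul_self {ι : Type*} [Fintype ι] [DecidableEq ι] (φ : ℂ) (α : ι → Fin 4) :
    pauliString φ α * pauliString φ α = φ ^ 2 • 1 := by
  ext x y
  have h := Finset.prod_univ_sum (fun _ : ι => (Finset.univ : Finset (Fin 2)))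
    fun j z => pauliMat (α j) (x j) z * pauliMat (α j) z (y j)
  simp only [← Matrix.mul_apply, pauliMat_mul_self, Fintype.piFinset_univ, prod_one_apply] at h
  rw [Matrix.smul_apply, h, smul_eq_mul, Matrix.mul_apply, Finset.mul_sum]
  refine Finset.sum_congr rfl fun z _ => ?_
  simp only [pauliString, Matrix.of_apply, Finset.prod_mul_distrib]
  ring

theorem pauliString_trace {ι : Type*} [Fintype ι] [DecidableEq ι] (φ : ℂ) (α : ι → Fin 4) :
    (pauliString φ α).trace = φ * ∏ j, (pauliMat (α j)).trace := by
  simp only [Matrix.trace, Matrix.diag_apply, pauliString, Matrix.of_apply, ← Finset.mul_sum,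
    Finset.prod_univ_sum, Fintype.piFinset_univ]

theorem pauliString_trace_of_ne_zero {ι : Type*} [Fintype ι] [DecidableEq ι] (φ : ℂ)
    {α : ι → Fin 4} (hα : α ≠ 0) : (pauliString φ α).trace = 0 := by
  obtain ⟨j, hj⟩ := Function.ne_iff.mp hα
  rw [pauliString_trace, Finset.prod_eq_zero (Finset.mem_univ j) (pauliMat_trace_of_ne_zero hj),
    mul_zero]

/-- A finite set closed under multiplication and consisting of involutions has
`(∑ h) ^ 2 = |H| • ∑ h`. -/
theorem sum_sq_of_mul_self_eq_one {R : Type*} [Ring R] (H : Finset R)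
    (hmul : ∀ g ∈ H, ∀ h ∈ H, g * h ∈ H) (hsq : ∀ g ∈ H, g * g = 1) :
    (∑ h ∈ H, h) ^ 2 = H.card • ∑ h ∈ H, h := by
  have key : ∀ g ∈ H, g * ∑ h ∈ H, h = ∑ h ∈ H, h := fun g hg => by
    rw [Finset.mul_sum]
    exact Finset.sum_bij' (fun h _ => g * h) (fun h _ => g * h) (fun h hh => hmul g hg h hh)
      (fun h hh => hmul g hg h hh) (fun h _ => by rw [← mul_assoc, hsq g hg, one_mul])
      (fun h _ => by rw [← mul_assoc, hsq g hg, one_mul]) fun _ _ => rfl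
  rw [sq, Finset.sum_mul, Finset.sum_congr rfl key, Finset.sum_const]

theorem Matrix.IsHermitian.posSemidef_of_sq_eq_smul {m : Type*} [Fintype m] [DecidableEq m]
    {A : Matrix m m ℂ} (hA : A.IsHermitian) {c : ℂ} (hc : 0 < c) (h : A ^ 2 = c • A) :
    A.PosSemidef := by
  have hA' : A = c⁻¹ • (Aᴴ * A) := by
    rw [hA.eq, ← sq, h, smul_smul, inv_mul_cancel₀ hc.ne', one_smul]
  rw [hA']
  exact (Matrix.posSemidef_conjTranspose_mul_self A).smul (inv_nonneg.mpr hc.le)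

theorem eq_zero_or_eq_of_mem_spectrum_of_sq_eq_smul {𝕜 R : Type*} [Field 𝕜] [Ring R]
    [Algebra 𝕜 R] {a : R} {c μ : 𝕜} (h : a ^ 2 = c • a) (hμ : μ ∈ spectrum 𝕜 a) :
    μ = 0 ∨ μ = c := by
  have : Nontrivial R := by
    by_contra hR
    rw [not_nontrivial_iff_subsingleton] at hR
    simp [spectrum.of_subsingleton] at hμ
  have hp := spectrum.subset_polynomial_aeval a
    (Polynomial.X ^ 2 - Polynomial.C c * Polynomial.X) ⟨μ, hμ, rfl⟩
  simp only [map_sub, map_pow, map_mul, Polynomial.aeval_X, Polynomial.aeval_C, h,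
    ← Algebra.smul_def, sub_self, spectrum.zero_eq, Set.mem_singleton_iff,
    Polynomial.eval_sub, Polynomial.eval_pow, Polynomial.eval_mul, Polynomial.eval_X,
    Polynomial.eval_C] at hp
  rw [sq, ← sub_mul, mul_eq_zero, sub_eq_zero] at hp
  exact hp.symm

/-- if `H` is a finite abelian group (under matrix multiplication) of
`n`-qubit Pauli strings with phases `±1` such that `-I ∉ H`, then
`ρ = 2⁻ⁿ ∑_{h ∈ H} h` is Hermitian, has trace `1`, satisfies `ρ² = (|H|/2ⁿ)·ρ`,
is positive semidefinite, and every eigenvalue of `ρ` is `0` or `|H|/2ⁿ`. -/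
theorem stabilizer_projector
    (n : ℕ) (hn : 1 ≤ n)
    (H : Finset (Matrix (Fin n → Fin 2) (Fin n → Fin 2) ℂ))
    (hPauli : ∀ g ∈ H, ∃ φ : ℂ, (φ = 1 ∨ φ = -1) ∧ ∃ α : Fin n → Fin 4, g = pauliString φ α)
    (hone : (1 : Matrix (Fin n → Fin 2) (Fin n → Fin 2) ℂ) ∈ H)
    (hmul : ∀ g ∈ H, ∀ h ∈ H, g * h ∈ H)
    (hinv : ∀ g ∈ H, g⁻¹ ∈ H)
    (hcomm : ∀ g ∈ H, ∀ h ∈ H, g * h = h * g)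
    (hnegI : (-1 : Matrix (Fin n → Fin 2) (Fin n → Fin 2) ℂ) ∉ H) :
    letI ρ : Matrix (Fin n → Fin 2) (Fin n → Fin 2) ℂ := ((2 : ℂ) ^ n)⁻¹ • ∑ h ∈ H, h
    ρ.IsHermitian ∧ ρ.trace = 1 ∧ ρ ^ 2 = ((H.card : ℂ) / 2 ^ n) • ρ ∧ ρ.PosSemidef ∧
      ∀ μ ∈ spectrum ℂ ρ, μ = 0 ∨ μ = (H.card : ℂ) / 2 ^ n := by
  have hherm : ∀ g ∈ H, g.IsHermitian := fun g hg => by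
    obtain ⟨φ, hφ, α, rfl⟩ := hPauli g hg
    exact pauliString_isHermitian (by rcases hφ with rfl | rfl <;> simp) α
  have hsq : ∀ g ∈ H, g * g = 1 := fun g hg => by
    obtain ⟨φ, hφ, α, rfl⟩ := hPauli g hg
    rw [pauliString_mul_self]
    rcases hφ with rfl | rfl <;> simp
  have htr : ∀ g ∈ H, g ≠ 1 → g.trace = 0 := fun g hg hne => by
    obtain ⟨φ, hφ, α, rfl⟩ := hPauli g hg
    refine pauliString_trace_of_ne_zero φ fun hα => ?_
    subst hα
    rw [pauliString_zero] at hg hne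
    rcases hφ with rfl | rfl
    · exact hne (one_smul _ _)
    · exact hnegI (by simpa using hg)
  have hH : (((2 : ℂ) ^ n)⁻¹ • ∑ h ∈ H, h).IsHermitian := by
    rw [Matrix.IsHermitian, Matrix.conjTranspose_smul, Matrix.conjTranspose_sum,
      Finset.sum_congr rfl fun g hg => (hherm g hg).eq]
    simp
  have hρ : (((2 : ℂ) ^ n)⁻¹ • ∑ h ∈ H, h) ^ 2 =
      ((H.card : ℂ) / 2 ^ n) • (((2 : ℂ) ^ n)⁻¹ • ∑ h ∈ H, h) := by
    rw [smul_pow, sum_sq_of_mul_self_eq_one H hmul hsq, ← Nat.cast_smul_eq_nsmul ℂ, smul_smul,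
      smul_smul]
    congr 1
    ring
  have hc : 0 < (H.card : ℂ) / 2 ^ n := by
    have : 0 < (H.card : ℂ) := Nat.cast_pos.mpr (Finset.card_pos.mpr ⟨1, hone⟩)
    positivity
  refine ⟨hH, ?_, hρ, hH.posSemidef_of_sq_eq_smul hc hρ,
    fun μ hμ => eq_zero_or_eq_of_mem_spectrum_of_sq_eq_smul hρ hμ⟩
  rw [Matrix.trace_smul, Matrix.trace_sum, Finset.sum_eq_single_of_mem 1 hone htr]
  simp
end

section
/- Let σ be a Hermitian complex matrix and ν a real number with σ² = ν·σ⁴. Then every nonzero eigenvalue μ of σ satisfies μ²·ν = 1. If moreover Tr(σ) = 1, then ν = (D₊ − D₋)², where D₊ and D₋ denote the numbers of positive and negative eigenvalues of σ (counted with multiplicity). -/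
open Matrix BigOperators

theorem Matrix.pow_mulVec_of_mulVec_eq_smul {n R : Type*} [Fintype n] [DecidableEq n]
    [CommSemiring R] {A : Matrix n n R} {v : n → R} {c : R} (h : A *ᵥ v = c • v) (k : ℕ) :
    (A ^ k) *ᵥ v = c ^ k • v := by
  induction k with
  | zero => simp
  | succ k ih => rw [pow_succ, ← mulVec_mulVec, h, mulVec_smul, ih, smul_smul, pow_succ']

/-- if `σ` is Hermitian with `σ² = ν·σ⁴`, then every nonzero eigenvalue `μ`
of `σ` satisfies `μ²·ν = 1`, and if moreover `Tr σ = 1` then `ν = (D₊ − D₋)²`, where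
`D₊`/`D₋` count the positive/negative eigenvalues (with multiplicity). -/
theorem eigenvalues_of_flat_partial_transpose
    (d : ℕ) (σ : Matrix (Fin d) (Fin d) ℂ) (hσ : σ.IsHermitian) (ν : ℝ)
    (h : σ ^ 2 = (ν : ℂ) • σ ^ 4) :
    (∀ i : Fin d, hσ.eigenvalues i ≠ 0 → (hσ.eigenvalues i) ^ 2 * ν = 1) ∧
    (σ.trace = 1 →
      ν = (((Finset.univ.filter fun i => 0 < hσ.eigenvalues i).card : ℝ) -
            ((Finset.univ.filter fun i => hσ.eigenvalues i < 0).card : ℝ)) ^ 2) := by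
  have flat : ∀ i : Fin d, hσ.eigenvalues i ≠ 0 → (hσ.eigenvalues i) ^ 2 * ν = 1 := by
    intro i hi
    set v : Fin d → ℂ := ⇑(hσ.eigenvectorBasis i) with hv
    have hv0 : v ≠ 0 := by
      intro h0
      apply hσ.eigenvectorBasis.toBasis.ne_zero i
      ext j
      simpa [hv] using congrFun h0 j
    have heig : σ *ᵥ v = (hσ.eigenvalues i : ℂ) • v := by
      rw [hv, hσ.mulVec_eigenvectorBasis i]
      ext j
      simp
    have key := congrArg (· *ᵥ v) h
    simp only [smul_mulVec, pow_mulVec_of_mulVec_eq_smul heig, smul_smul] at key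
    have hc := smul_left_injective ℂ hv0 key
    norm_cast at hc
    have h2 : (hσ.eigenvalues i) ^ 2 ≠ 0 := pow_ne_zero 2 hi
    apply mul_left_cancel₀ h2
    linarith
  refine ⟨flat, fun htr => ?_⟩
  have hsum : ∑ i, hσ.eigenvalues i = 1 := by
    have := hσ.trace_eq_sum_eigenvalues
    rw [htr] at this
    apply Complex.ofReal_injective
    simpa using this.symm
  obtain ⟨i₀, -, hi₀⟩ := Finset.exists_ne_zero_of_sum_ne_zero (hsum.trans_ne one_ne_zero)
  have hν : 0 ≤ ν := by
    by_contra! hneg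
    nlinarith [flat i₀ hi₀, sq_nonneg (hσ.eigenvalues i₀)]
  have hsqrt := Real.sq_sqrt hν
  have hs0 := Real.sqrt_nonneg ν
  have hsign : ∀ i, hσ.eigenvalues i * √ν =
      (if 0 < hσ.eigenvalues i then 1 else 0) - (if hσ.eigenvalues i < 0 then 1 else 0) := by
    intro i
    have hsq : hσ.eigenvalues i ≠ 0 →
        hσ.eigenvalues i * √ν = 1 ∨ hσ.eigenvalues i * √ν = -1 := fun hi =>
      sq_eq_sq_iff_eq_or_eq_neg.mp (by rw [mul_pow, hsqrt, flat i hi, one_pow])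
    rcases lt_trichotomy (hσ.eigenvalues i) 0 with hi | hi | hi
    · rw [if_neg hi.not_gt, if_pos hi]
      rcases hsq hi.ne with h1 | h1
      · linarith [mul_nonpos_of_nonpos_of_nonneg hi.le hs0]
      · linarith
    · simp [hi]
    · rw [if_pos hi, if_neg hi.not_gt]
      rcases hsq hi.ne' with h1 | h1
      · linarith
      · linarith [mul_nonneg hi.le hs0]
  have hroot : √ν = ((Finset.univ.filter fun i => 0 < hσ.eigenvalues i).card : ℝ) -
      ((Finset.univ.filter fun i => hσ.eigenvalues i < 0).card : ℝ) := by
    rw [← one_mul √ν, ← hsum, Finset.sum_mul, Finset.sum_congr rfl fun i _ => hsign i,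
      Finset.sum_sub_distrib, Finset.sum_boole, Finset.sum_boole]
  rw [← hroot, hsqrt]
end

section
/- Let g ≥ 1 and let σ_A^1, …, σ_A^g ∈ M_{d_A}(ℂ) and σ_B^1, …, σ_B^g ∈ M_{d_B}(ℂ) be Hermitian positive semidefinite matrices of trace 1 satisfying σ_A^k σ_A^l = 0 and σ_B^k σ_B^l = 0 for all k ≠ l. Let p_1, …, p_g > 0 with ∑_k p_k = 1, and set τ = ∑_k p_k (σ_A^k)ᵀ ⊗ σ_B^k (the partial transpose over A of ρ = ∑_k p_k σ_A^k ⊗ σ_B^k, with ⊗ the Kronecker product). If there exists a real number λ with τ² = λ·τ⁴, then p_i²/p_j² is rational for all i, j ∈ {1, …, g}. -/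
open Matrix BigOperators Kronecker
open scoped ComplexOrder

/-- If a positive semidefinite matrix satisfies `M ^ 3 = c • M ^ 5`, then its nonzero eigenvalues all
equal `(√c)⁻¹`, so its trace is a natural multiple of `(√c)⁻¹`. -/
theorem Matrix.PosSemidef.exists_trace_eq_nat_mul_of_pow_three_eq {n : Type*} [Fintype n]
    [DecidableEq n] {M : Matrix n n ℂ} (hM : M.PosSemidef) {c : ℝ}
    (h : M ^ 3 = (c : ℂ) • M ^ 5) : ∃ m : ℕ, M.trace = ((m * (√c)⁻¹ : ℝ) : ℂ) := by
  have heig (i : n) : hM.isHermitian.eigenvalues i = 0 ∨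
      hM.isHermitian.eigenvalues i = (√c)⁻¹ := by
    set x := hM.isHermitian.eigenvalues i with hx
    set v : n → ℂ := ⇑(hM.isHermitian.eigenvectorBasis i) with hv
    have hMv : M *ᵥ v = (x : ℂ) • v := by
      rw [hv, hM.isHermitian.mulVec_eigenvectorBasis i, ← hx]
      ext j
      simp
    have hpow (k : ℕ) : M ^ k *ᵥ v = ((x : ℂ) ^ k) • v := by
      induction k with
      | zero => simp
      | succ k ih => rw [pow_succ, ← mulVec_mulVec, hMv, mulVec_smul, ih, smul_smul, pow_succ']
    have hv0 : v ≠ 0 := by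
      intro h0
      apply hM.isHermitian.eigenvectorBasis.orthonormal.ne_zero i
      ext j
      exact congrFun h0 j
    have hxv : ((x : ℂ) ^ 3) • v = ((c : ℂ) * (x : ℂ) ^ 5) • v := by
      rw [← hpow, h, smul_mulVec, hpow, smul_smul]
    have hxc : x ^ 3 = c * x ^ 5 := by exact_mod_cast smul_left_injective ℂ hv0 hxv
    refine or_iff_not_imp_left.2 fun hx0 => ?_
    have hcx : c = x⁻¹ ^ 2 := by
      field_simp
      exact mul_left_cancel₀ (pow_ne_zero 3 hx0) (by linarith)
    rw [hcx, Real.sqrt_sq (inv_nonneg.2 (hM.eigenvalues_nonneg i)), inv_inv]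
  refine ⟨(Finset.univ.filter fun i => hM.isHermitian.eigenvalues i ≠ 0).card, ?_⟩
  rw [hM.isHermitian.trace_eq_sum_eigenvalues, ← nsmul_eq_mul, ← Finset.sum_const,
    Finset.sum_filter, Complex.ofReal_sum]
  refine Finset.sum_congr rfl fun i _ => ?_
  rcases eq_or_ne (hM.isHermitian.eigenvalues i) 0 with h0 | h0
  · simp [h0]
  · rw [if_pos h0, (heig i).resolve_left h0]
    rfl

/-- For a pairwise orthogonal family, powers of the sum restrict to powers of each summand. -/
theorem mul_sum_pow_eq_pow_succ {ι R : Type*} [Fintype ι] [Semiring R] {X : ι → R}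
    (hX : ∀ k l, k ≠ l → X k * X l = 0) (k : ι) (n : ℕ) :
    X k * (∑ l, X l) ^ n = X k ^ (n + 1) := by
  induction n with
  | zero => simp
  | succ n ih =>
    have hk : X k * ∑ l, X l = X k * X k := by
      rw [Finset.mul_sum]
      exact Finset.sum_eq_single k (fun l _ hl => hX k l hl.symm) (by simp)
    rw [pow_succ, ← mul_assoc, ih, pow_succ, mul_assoc, hk, ← mul_assoc, ← pow_succ, ← pow_succ]

/-- let `σ_A^k`, `σ_B^k` be Hermitian PSD trace-one matrices with
`σ_A^k σ_A^l = 0` and `σ_B^k σ_B^l = 0` for `k ≠ l`, and `p_k > 0` with `∑ p_k = 1`.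
If `τ = ∑_k p_k (σ_A^k)ᵀ ⊗ σ_B^k` satisfies `τ² = λ·τ⁴` for some real `λ`, then
`p_i²/p_j²` is rational for all `i, j`. -/
theorem rationality_from_flat_partial_transpose
    (dA dB g : ℕ) (hg : 1 ≤ g)
    (σA : Fin g → Matrix (Fin dA) (Fin dA) ℂ) (σB : Fin g → Matrix (Fin dB) (Fin dB) ℂ)
    (hApsd : ∀ k, (σA k).PosSemidef) (hBpsd : ∀ k, (σB k).PosSemidef)
    (hAtr : ∀ k, (σA k).trace = 1) (hBtr : ∀ k, (σB k).trace = 1)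
    (hAorth : ∀ k l, k ≠ l → σA k * σA l = 0)
    (hBorth : ∀ k l, k ≠ l → σB k * σB l = 0)
    (p : Fin g → ℝ) (hp : ∀ k, 0 < p k) (hsum : ∑ k, p k = 1)
    (hflat : ∃ lam : ℝ,
      (∑ k, (p k : ℂ) • ((σA k)ᵀ ⊗ₖ σB k)) ^ 2 =
        (lam : ℂ) • (∑ k, (p k : ℂ) • ((σA k)ᵀ ⊗ₖ σB k)) ^ 4) :
    ∀ i j, ∃ q : ℚ, (p i) ^ 2 / (p j) ^ 2 = (q : ℝ) := by
  obtain ⟨c, hc⟩ := hflat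
  set X : Fin g → Matrix (Fin dA × Fin dB) (Fin dA × Fin dB) ℂ :=
    fun k => (p k : ℂ) • ((σA k)ᵀ ⊗ₖ σB k) with hXdef
  have hX (k l : Fin g) (hkl : k ≠ l) : X k * X l = 0 := by
    simp only [hXdef, smul_mul_smul_comm, ← mul_kronecker_mul, hBorth k l hkl, kronecker_zero,
      smul_zero]
  have hXpsd (k : Fin g) : (X k).PosSemidef :=
    ((hApsd k).transpose.kronecker (hBpsd k)).smul (by exact_mod_cast (hp k).le)
  have hXtr (k : Fin g) : (X k).trace = p k := by
    simp [hXdef, trace_smul, trace_kronecker, hAtr, hBtr]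
  have hXpow (k : Fin g) : X k ^ 3 = (c : ℂ) • X k ^ 5 := by
    rw [← mul_sum_pow_eq_pow_succ hX k 2, ← mul_sum_pow_eq_pow_succ hX k 4, hc, mul_smul_comm]
  have hpm (k : Fin g) : ∃ m : ℕ, p k = m * (√c)⁻¹ := by
    obtain ⟨m, hm⟩ := (hXpsd k).exists_trace_eq_nat_mul_of_pow_three_eq (hXpow k)
    exact ⟨m, by exact_mod_cast (hXtr k).symm.trans hm⟩
  intro i j
  obtain ⟨m, hm⟩ := hpm i
  obtain ⟨n, hn⟩ := hpm j
  have hs : (√c)⁻¹ ≠ 0 := right_ne_zero_of_mul (hm ▸ (hp i).ne')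
  refine ⟨(m : ℚ) ^ 2 / (n : ℚ) ^ 2, ?_⟩
  rw [hm, hn, mul_pow, mul_pow, mul_div_mul_right _ _ (pow_ne_zero 2 hs)]
  push_cast
  rfl
end

section
/- Let g ≥ 1 and let σ_A^1, …, σ_A^g ∈ M_{d_A}(ℂ) and σ_B^1, …, σ_B^g ∈ M_{d_B}(ℂ) be Hermitian positive semidefinite matrices of trace 1 satisfying σ_A^k σ_A^l = 0 and σ_B^k σ_B^l = 0 for all k ≠ l, and let p_1, …, p_g ≥ 0 with ∑_k p_k = 1. Then S(∑_k p_k σ_A^k) + S(∑_k p_k σ_B^k) − S(∑_k p_k σ_A^k ⊗ σ_B^k) = H({p_k}), where ⊗ is the Kronecker product; that is, the mutual information of the bipartite state ∑_k p_k σ_A^k ⊗ σ_B^k equals the Shannon entropy of the weights. -/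
open Matrix BigOperators Kronecker
open scoped ComplexOrder

/-- Base-2 von Neumann entropy of a (Hermitian) matrix: `S(ρ) = −∑ μᵢ log₂ μᵢ` over the
eigenvalues with multiplicity (and `0` if `ρ` is not Hermitian). -/
noncomputable def vnEntropy {m : Type*} [Fintype m] [DecidableEq m] (ρ : Matrix m m ℂ) : ℝ := by
  classical exact
    if h : ρ.IsHermitian then -∑ i, h.eigenvalues i * Real.logb 2 (h.eigenvalues i) else 0

/-- Finite families of reals with equal positive power sums have equal sums of `f` for every
function `f` vanishing at zero. -/
theorem sum_comp_eq_of_sum_pow_eq {ι κ : Type*} [Fintype ι] [Fintype κ] (x : ι → ℝ) (y : κ → ℝ)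
    (h : ∀ n : ℕ, ∑ i, x i ^ (n + 1) = ∑ j, y j ^ (n + 1)) (f : ℝ → ℝ) (hf : f 0 = 0) :
    ∑ i, f (x i) = ∑ j, f (y j) := by
  classical
  set s : Finset ℝ := {0} ∪ Finset.univ.image x ∪ Finset.univ.image y with hs
  set q : Polynomial ℝ := Lagrange.interpolate s id f
  have hq : ∀ v ∈ s, f v = q.eval v := fun v hv =>
    (Lagrange.eval_interpolate_at_node f Function.injective_id.injOn hv).symm
  have hq0 : q.coeff 0 = 0 := by
    rw [Polynomial.coeff_zero_eq_eval_zero, ← hq 0 (by simp [hs]), hf]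
  have expand : ∀ v ∈ s, f v = ∑ n ∈ Finset.range q.natDegree, q.coeff (n + 1) * v ^ (n + 1) := by
    intro v hv
    rw [hq v hv, Polynomial.eval_eq_sum_range, Finset.sum_range_succ']
    simp [hq0]
  calc ∑ i, f (x i)
      = ∑ i, ∑ n ∈ Finset.range q.natDegree, q.coeff (n + 1) * x i ^ (n + 1) :=
        Finset.sum_congr rfl fun i _ => expand _ (by simp [hs])
    _ = ∑ j, ∑ n ∈ Finset.range q.natDegree, q.coeff (n + 1) * y j ^ (n + 1) := by
        rw [Finset.sum_comm, Finset.sum_comm (s := Finset.univ (α := κ))]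
        simp_rw [← Finset.mul_sum, h]
    _ = ∑ j, f (y j) :=
        Finset.sum_congr rfl fun j _ => (expand _ (by simp [hs])).symm

/-- The trace of a power of a Hermitian matrix is the power sum of its eigenvalues. -/
theorem Matrix.IsHermitian.trace_pow_eq_sum_eigenvalues_pow {m : Type*} [Fintype m]
    [DecidableEq m] {A : Matrix m m ℂ} (hA : A.IsHermitian) (n : ℕ) :
    (A ^ n).trace = ((∑ i, hA.eigenvalues i ^ n : ℝ) : ℂ) := by
  conv_lhs => rw [hA.spectral_theorem, ← map_pow, Unitary.conjStarAlgAut_apply,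
    Matrix.trace_mul_cycle, Unitary.coe_star_mul_self, one_mul, Matrix.diagonal_pow,
    Matrix.trace_diagonal]
  simp

theorem Matrix.IsHermitian.sum_eigenvalues_eq_one {m : Type*} [Fintype m] [DecidableEq m]
    {A : Matrix m m ℂ} (hA : A.IsHermitian) (htr : A.trace = 1) :
    ∑ i, hA.eigenvalues i = 1 := by
  have h := hA.trace_pow_eq_sum_eigenvalues_pow 1
  simp only [pow_one, htr] at h
  exact_mod_cast h.symm

/-- Positive powers distribute over sums of pairwise annihilating elements. -/
theorem sum_pow_succ_of_pairwise_mul_eq_zero {ι R : Type*} [Fintype ι] [Semiring R] (a : ι → R)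
    (h : ∀ k l, k ≠ l → a k * a l = 0) (n : ℕ) :
    (∑ k, a k) ^ (n + 1) = ∑ k, a k ^ (n + 1) := by
  induction n with
  | zero => simp
  | succ n ih =>
    rw [pow_succ, ih, Finset.sum_mul]
    refine Finset.sum_congr rfl fun k _ => ?_
    rw [Finset.mul_sum, Finset.sum_eq_single k, ← pow_succ]
    · intro l _ hl
      rw [pow_succ, mul_assoc, h k l hl.symm, mul_zero]
    · simp

theorem Matrix.kronecker_pow {m n R : Type*} [Fintype m] [Fintype n] [DecidableEq m]
    [DecidableEq n] [CommSemiring R] (A : Matrix m m R) (B : Matrix n n R) (r : ℕ) :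
    (A ⊗ₖ B) ^ r = (A ^ r) ⊗ₖ (B ^ r) := by
  induction r with
  | zero => simp
  | succ r ih => rw [pow_succ, ih, ← Matrix.mul_kronecker_mul, ← pow_succ, ← pow_succ]

/-- The entropy of a Hermitian matrix is determined by its power traces. -/
theorem vnEntropy_eq_of_trace_pow {m ι : Type*} [Fintype m] [DecidableEq m] [Fintype ι]
    {A : Matrix m m ℂ} (hA : A.IsHermitian) (x : ι → ℝ)
    (h : ∀ n : ℕ, (A ^ (n + 1)).trace = ((∑ i, x i ^ (n + 1) : ℝ) : ℂ)) :
    vnEntropy A = -∑ i, x i * Real.logb 2 (x i) := by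
  rw [vnEntropy, dif_pos hA, neg_inj]
  refine sum_comp_eq_of_sum_pow_eq _ x (fun n => ?_) (fun v => v * Real.logb 2 v) (by simp)
  have := h n
  rw [hA.trace_pow_eq_sum_eigenvalues_pow] at this
  exact_mod_cast this

theorem Matrix.isHermitian_sum_ofReal_smul {m ι : Type*} [Fintype ι] (σ : ι → Matrix m m ℂ)
    (hσ : ∀ k, (σ k).IsHermitian) (p : ι → ℝ) : (∑ k, (p k : ℂ) • σ k).IsHermitian := by
  simp only [Matrix.IsHermitian, Matrix.conjTranspose_sum, Matrix.conjTranspose_smul,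
    (hσ _).eq, RCLike.star_def, Complex.conj_ofReal]

/-- Powers of a mixture of pairwise orthogonal matrices have additive traces. -/
theorem Matrix.trace_sum_smul_pow_succ {m ι : Type*} [Fintype m] [DecidableEq m] [Fintype ι]
    (σ : ι → Matrix m m ℂ) (horth : ∀ k l, k ≠ l → σ k * σ l = 0) (c : ι → ℂ) (n : ℕ) :
    ((∑ k, c k • σ k) ^ (n + 1)).trace = ∑ k, c k ^ (n + 1) * (σ k ^ (n + 1)).trace := by
  rw [sum_pow_succ_of_pairwise_mul_eq_zero _ fun k l hkl => by simp [horth k l hkl],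
    Matrix.trace_sum]
  simp_rw [smul_pow, Matrix.trace_smul, smul_eq_mul]

theorem mul_logb_mul (b x y : ℝ) :
    x * y * Real.logb b (x * y) = y * (x * Real.logb b x) + x * (y * Real.logb b y) := by
  rcases eq_or_ne x 0 with rfl | hx
  · simp
  rcases eq_or_ne y 0 with rfl | hy
  · simp
  rw [Real.logb_mul hx hy]
  ring

/-- Entropy of a mixture of pairwise orthogonal states. -/
theorem vnEntropy_sum_smul_of_orthogonal {m ι : Type*} [Fintype m] [DecidableEq m] [Fintype ι]
    (σ : ι → Matrix m m ℂ) (hσ : ∀ k, (σ k).IsHermitian) (htr : ∀ k, (σ k).trace = 1)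
    (horth : ∀ k l, k ≠ l → σ k * σ l = 0) (p : ι → ℝ) :
    vnEntropy (∑ k, (p k : ℂ) • σ k) =
      -∑ k, p k * Real.logb 2 (p k) + ∑ k, p k * vnEntropy (σ k) := by
  have hone : ∀ k, ∑ i, (hσ k).eigenvalues i = 1 := fun k =>
    (hσ k).sum_eigenvalues_eq_one (htr k)
  rw [vnEntropy_eq_of_trace_pow (Matrix.isHermitian_sum_ofReal_smul σ hσ p)
    (fun z : ι × m => p z.1 * (hσ z.1).eigenvalues z.2)]
  · simp_rw [Fintype.sum_prod_type, mul_logb_mul, Finset.sum_add_distrib, ← Finset.sum_mul,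
      ← Finset.mul_sum, hone, one_mul, vnEntropy, dif_pos (hσ _), mul_neg,
      Finset.sum_neg_distrib]
    ring
  · intro n
    rw [Matrix.trace_sum_smul_pow_succ σ horth]
    simp_rw [(hσ _).trace_pow_eq_sum_eigenvalues_pow, Fintype.sum_prod_type, mul_pow,
      ← Finset.mul_sum]
    push_cast
    rfl

/-- Entropy is additive under Kronecker products of states. -/
theorem vnEntropy_kronecker {m n : Type*} [Fintype m] [DecidableEq m] [Fintype n] [DecidableEq n]
    {A : Matrix m m ℂ} {B : Matrix n n ℂ} (hA : A.IsHermitian) (hB : B.IsHermitian)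
    (hAtr : A.trace = 1) (hBtr : B.trace = 1) :
    vnEntropy (A ⊗ₖ B) = vnEntropy A + vnEntropy B := by
  have hAone : ∑ i, hA.eigenvalues i = 1 := hA.sum_eigenvalues_eq_one hAtr
  have hBone : ∑ i, hB.eigenvalues i = 1 := hB.sum_eigenvalues_eq_one hBtr
  have hAB : (A ⊗ₖ B).IsHermitian := by
    rw [Matrix.IsHermitian, Matrix.conjTranspose_kronecker, hA.eq, hB.eq]
  rw [vnEntropy_eq_of_trace_pow hAB (fun z : m × n => hA.eigenvalues z.1 * hB.eigenvalues z.2)]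
  · simp_rw [Fintype.sum_prod_type, mul_logb_mul, Finset.sum_add_distrib, ← Finset.mul_sum,
      ← Finset.sum_mul, hAone, hBone, one_mul, vnEntropy, dif_pos hA, dif_pos hB]
    ring
  · intro r
    rw [Matrix.kronecker_pow, Matrix.trace_kronecker, hA.trace_pow_eq_sum_eigenvalues_pow,
      hB.trace_pow_eq_sum_eigenvalues_pow, ← Complex.ofReal_mul, Finset.sum_mul_sum]
    simp_rw [Fintype.sum_prod_type, mul_pow]

/-- for locally orthogonal families of Hermitian PSD trace-one matrices
`σ_A^k`, `σ_B^k` and weights `p_k ≥ 0` with `∑ p_k = 1`, the mutual information of the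
bipartite state `∑_k p_k σ_A^k ⊗ σ_B^k` equals the Shannon entropy of the weights:
`S(∑ p_k σ_A^k) + S(∑ p_k σ_B^k) − S(∑ p_k σ_A^k ⊗ σ_B^k) = H({p_k})`. -/
theorem mutual_information_of_orthogonal_mixture
    (dA dB g : ℕ) (hg : 1 ≤ g)
    (σA : Fin g → Matrix (Fin dA) (Fin dA) ℂ) (σB : Fin g → Matrix (Fin dB) (Fin dB) ℂ)
    (hApsd : ∀ k, (σA k).PosSemidef) (hBpsd : ∀ k, (σB k).PosSemidef)
    (hAtr : ∀ k, (σA k).trace = 1) (hBtr : ∀ k, (σB k).trace = 1)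
    (hAorth : ∀ k l, k ≠ l → σA k * σA l = 0)
    (hBorth : ∀ k l, k ≠ l → σB k * σB l = 0)
    (p : Fin g → ℝ) (hp : ∀ k, 0 ≤ p k) (hsum : ∑ k, p k = 1) :
    vnEntropy (∑ k, (p k : ℂ) • σA k) + vnEntropy (∑ k, (p k : ℂ) • σB k) -
        vnEntropy (∑ k, (p k : ℂ) • (σA k ⊗ₖ σB k)) =
      -∑ k, p k * Real.logb 2 (p k) := by
  have hA k := (hApsd k).isHermitian
  have hB k := (hBpsd k).isHermitian
  have hAB k : (σA k ⊗ₖ σB k).IsHermitian := by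
    rw [Matrix.IsHermitian, Matrix.conjTranspose_kronecker, (hA k).eq, (hB k).eq]
  rw [vnEntropy_sum_smul_of_orthogonal σA hA hAtr hAorth p,
    vnEntropy_sum_smul_of_orthogonal σB hB hBtr hBorth p,
    vnEntropy_sum_smul_of_orthogonal (fun k => σA k ⊗ₖ σB k) hAB
      (fun k => by rw [Matrix.trace_kronecker, hAtr, hBtr, one_mul])
      (fun k l hkl => by rw [← Matrix.mul_kronecker_mul, hAorth k l hkl,
        Matrix.zero_kronecker]) p]
  simp_rw [fun k => vnEntropy_kronecker (hA k) (hB k) (hAtr k) (hBtr k), mul_add,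
    Finset.sum_add_distrib]
  ring
end

section
/- Set p₁ = 1/10 and p₂ = 3^(−1/4)/10. There exists t ∈ (0, 1) such that, with p₃ = t and p₄ = 1 − t − p₁ − p₂, all four numbers p₁, p₂, p₃, p₄ are strictly positive and −∑_{k=1}^{4} p_k log₂ p_k = 1. Moreover, for any such t, p₁²/p₂² = √3 is irrational. -/
/-- The tangent line of the concave function `negMulLog` at `a` bounds it from above. -/
theorem negMulLog_le_tangent {a x : ℝ} (ha : 0 < a) (hx : 0 < x) :
    Real.negMulLog x ≤ -x * Real.log a + a - x := by
  have h := Real.log_le_sub_one_of_pos (div_pos ha hx)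
  rw [Real.log_div ha.ne' hx.ne'] at h
  have h' := mul_le_mul_of_nonneg_left h hx.le
  have hxa : x * (a / x - 1) = a - x := by field_simp
  rw [hxa] at h'
  rw [Real.negMulLog]
  linarith

theorem mul_log_two_le_negMulLog {x : ℝ} (n : ℕ) (hx : 0 < x) (hxn : x ≤ (1 / 2) ^ n) :
    x * (n * Real.log 2) ≤ Real.negMulLog x := by
  have h := Real.log_le_log hx hxn
  rw [Real.log_pow, one_div, Real.log_inv] at h
  rw [Real.negMulLog]
  nlinarith

/-- The entropy in nats of `(1/10, q, t, 9/10 - q - t)` takes the value `log 2`. -/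
theorem exists_sum_negMulLog_eq_log_two {q : ℝ} (hq : 0 < q) (hq' : q < 2 / 25) :
    ∃ t ∈ Set.Ioo (0 : ℝ) (1 / 2),
      Real.negMulLog (1 / 10) + Real.negMulLog q + Real.negMulLog t +
        Real.negMulLog (1 - t - 1 / 10 - q) = Real.log 2 := by
  have hlog := Real.log_two_gt_d9
  refine intermediate_value_Ioo
    (f := fun t : ℝ ↦ Real.negMulLog (1 / 10) + Real.negMulLog q + Real.negMulLog t +
      Real.negMulLog (1 - t - 1 / 10 - q)) (by norm_num) ?_ ⟨?_, ?_⟩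
  · have := Real.continuous_negMulLog
    fun_prop
  · have h₁ : Real.negMulLog (1 / 10) ≤ 1 / 3 * Real.log 2 := by
      have h := Real.log_le_log (by norm_num) (by norm_num : (10 : ℝ) ^ 3 ≤ 2 ^ 10)
      rw [Real.log_pow, Real.log_pow] at h
      push_cast at h
      rw [Real.negMulLog, one_div, Real.log_inv]
      linarith
    have h₂ := negMulLog_le_tangent (a := (1 / 2) ^ 4) (by norm_num) hq
    have h₄ := negMulLog_le_tangent (a := 1) (x := 1 - 0 - 1 / 10 - q)
      (by norm_num) (by linarith)
    rw [Real.log_pow, one_div, Real.log_inv] at h₂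
    push_cast at h₂
    simp only [Real.negMulLog_zero, Real.log_one] at h₄ ⊢
    nlinarith
  · have h₁ := mul_log_two_le_negMulLog (x := 1 / 10) 3 (by norm_num) (by norm_num)
    have h₂ := Real.negMulLog_nonneg hq.le (by linarith)
    have h₃ := mul_log_two_le_negMulLog (x := 1 / 2) 1 (by norm_num) (by norm_num)
    have h₄ := mul_log_two_le_negMulLog (x := 1 - 1 / 2 - 1 / 10 - q) 1
      (by linarith) (by linarith)
    push_cast at h₁ h₃ h₄
    nlinarith

/-- with `p₁ = 1/10` and `p₂ = 3^(−1/4)/10`, there exists `t ∈ (0,1)` such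
that, setting `p₃ = t` and `p₄ = 1 − t − p₁ − p₂`, all four weights are strictly positive
and the Shannon entropy `−∑ p_k log₂ p_k` equals `1`. Moreover `p₁²/p₂² = √3` is
irrational. -/
theorem counterexample_candidate :
    (∃ t ∈ Set.Ioo (0 : ℝ) 1,
      0 < (1 / 10 : ℝ) ∧ 0 < (3 : ℝ) ^ (-(1 / 4 : ℝ)) / 10 ∧ 0 < t ∧
        0 < 1 - t - 1 / 10 - (3 : ℝ) ^ (-(1 / 4 : ℝ)) / 10 ∧
      -((1 / 10 : ℝ) * Real.logb 2 (1 / 10) +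
        ((3 : ℝ) ^ (-(1 / 4 : ℝ)) / 10) * Real.logb 2 ((3 : ℝ) ^ (-(1 / 4 : ℝ)) / 10) +
        t * Real.logb 2 t +
        (1 - t - 1 / 10 - (3 : ℝ) ^ (-(1 / 4 : ℝ)) / 10) *
          Real.logb 2 (1 - t - 1 / 10 - (3 : ℝ) ^ (-(1 / 4 : ℝ)) / 10)) = 1) ∧
    (1 / 10 : ℝ) ^ 2 / ((3 : ℝ) ^ (-(1 / 4 : ℝ)) / 10) ^ 2 = Real.sqrt 3 ∧
    Irrational ((1 / 10 : ℝ) ^ 2 / ((3 : ℝ) ^ (-(1 / 4 : ℝ)) / 10) ^ 2) := by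
  set s : ℝ := (3 : ℝ) ^ (-(1 / 4 : ℝ)) with hs
  have hs0 : 0 < s := by positivity
  have hs4 : s ^ 4 = 1 / 3 := by
    rw [hs, ← Real.rpow_natCast, ← Real.rpow_mul (by norm_num)]
    norm_num [Real.rpow_neg_one]
  have hs1 : s < 4 / 5 := lt_of_pow_lt_pow_left₀ 4 (by norm_num) (by rw [hs4]; norm_num)
  have hsqrt : (1 / 10 : ℝ) ^ 2 / (s / 10) ^ 2 = Real.sqrt 3 := by
    symm
    rw [Real.sqrt_eq_iff_mul_self_eq (by norm_num) (by positivity)]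
    field_simp
    linarith
  refine ⟨?_, hsqrt, ?_⟩
  · obtain ⟨t, ⟨ht0, ht1⟩, ht⟩ :=
      exists_sum_negMulLog_eq_log_two (q := s / 10) (by positivity) (by linarith)
    refine ⟨t, ⟨ht0, by linarith⟩, by norm_num, by positivity, ht0, by linarith, ?_⟩
    have hlog : Real.log 2 ≠ 0 := (Real.log_pos one_lt_two).ne'
    simp only [Real.negMulLog] at ht
    simp only [Real.logb, ← mul_div_assoc, ← add_div, ← neg_div]
    rw [div_eq_one_iff_eq hlog]
    linarith
  · rw [hsqrt]
    exact_mod_cast Nat.prime_three.irrational_sqrt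
end

section
/- Let φ ∈ ℝ and define the 3×3 complex matrices A⁰ = diag(1, 0, 0) and A¹ = diag(0, e^{iφ}, e^{−iφ}). Then for every N ≥ 1 and every i ∈ (Fin N → Fin 2): tr(A^{i₁} ⋯ A^{i_N}) = 1 if i_j = 0 for all j, tr(A^{i₁} ⋯ A^{i_N}) = 2·cos(Nφ) if i_j = 1 for all j, and tr(A^{i₁} ⋯ A^{i_N}) = 0 otherwise. That is, the generated translation-invariant MPS is |0⟩^⊗N + 2cos(Nφ)·|1⟩^⊗N. -/
open Matrix BigOperators

/-- The trace of an ordered product of diagonal matrices is the sum of the entrywise products. -/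
theorem trace_prod_ofFn_diagonal {n R : Type*} [Fintype n] [DecidableEq n] [CommSemiring R]
    {N : ℕ} (d : Fin N → n → R) :
    (List.ofFn fun j => Matrix.diagonal (d j)).prod.trace = ∑ k, ∏ j, d j k := by
  have h : (List.ofFn fun j => Matrix.diagonal (d j)).prod = Matrix.diagonal (∏ j, d j) := by
    have := map_list_prod (Matrix.diagonalRingHom n R) (List.ofFn d)
    rw [List.prod_ofFn, List.map_ofFn] at this
    exact this.symm
  simp [h, Matrix.trace_diagonal, Finset.prod_apply]

/-- for `A⁰ = diag(1,0,0)` and `A¹ = diag(0, e^{iφ}, e^{−iφ})`, the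
translation-invariant MPS amplitudes are `tr(A^{i₁}⋯A^{i_N}) = 1` on `i ≡ 0`,
`2·cos(Nφ)` on `i ≡ 1`, and `0` otherwise; i.e. the MPS is
`|0…0⟩ + 2cos(Nφ)·|1…1⟩`. -/
theorem mps_ghz_with_phases
    (φ : ℝ) (N : ℕ) (hN : 1 ≤ N) (i : Fin N → Fin 2) :
    letI A : Fin 2 → Matrix (Fin 3) (Fin 3) ℂ :=
      ![Matrix.diagonal ![1, 0, 0],
        Matrix.diagonal ![0, Complex.exp (φ * Complex.I), Complex.exp (-(φ * Complex.I))]]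
    (List.ofFn fun j => A (i j)).prod.trace =
      if ∀ j, i j = 0 then 1
      else if ∀ j, i j = 1 then ((2 * Real.cos (N * φ) : ℝ) : ℂ)
      else 0 := by
  have hA : ∀ b : Fin 2, (![Matrix.diagonal ![1, 0, 0],
        Matrix.diagonal ![0, Complex.exp (φ * Complex.I), Complex.exp (-(φ * Complex.I))]] :
        Fin 2 → Matrix (Fin 3) (Fin 3) ℂ) b = Matrix.diagonal
        ((![![1, 0, 0], ![0, Complex.exp (φ * Complex.I), Complex.exp (-(φ * Complex.I))]] :
          Fin 2 → Fin 3 → ℂ) b) := by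
    intro b
    fin_cases b <;> rfl
  simp only [hA, trace_prod_ofFn_diagonal, Fin.sum_univ_three]
  have hN0 : N ≠ 0 := by omega
  split_ifs with h0 h1
  · simp [h0, hN0]
  · simp only [h1]
    simp only [Finset.prod_const, Finset.card_univ, Fintype.card_fin, ← Complex.exp_nat_mul,
      Matrix.cons_val, zero_pow hN0, zero_add]
    push_cast
    rw [Complex.two_cos]
    ring_nf
  · push Not at h0 h1
    obtain ⟨a, ha⟩ := h0
    obtain ⟨b, hb⟩ := h1
    replace ha : i a = 1 := by omega
    replace hb : i b = 0 := by omega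
    rw [Finset.prod_eq_zero (Finset.mem_univ a) (by simp [ha]),
      Finset.prod_eq_zero (Finset.mem_univ b) (by simp [hb]),
      Finset.prod_eq_zero (Finset.mem_univ b) (by simp [hb])]
    simp
end
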